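/- Let d ≥ 1 and let B be a d×d Hermitian complex matrix with Tr(B) = 0 and Tr(B²) = 1. Let μ be the normalized rotation-invariant (uniform) probability measure on the unit sphere {ψ ∈ ℂ^d : ‖ψ‖ = 1}. Then ∫ ⟨ψ, B ψ⟩² dμ(ψ) = 1/(d(d+1)). -/

import Mathlib

open Matrix Finset MeasureTheory

theorem one_add_smul_mem_unitaryGroup {n : Type*} [Fintype n] [DecidableEq n]
    {P : Matrix n n ℂ} (hP : P.IsHermitian) (hPP : P * P = P) {z : ℂ}
    (hz : z + star z + z * star z = 0) :
    1 + z • P ∈ Matrix.unitaryGroup n ℂ := by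
  rw [Matrix.mem_unitaryGroup_iff, Matrix.star_eq_conjTranspose]
  simp only [conjTranspose_add, conjTranspose_one, conjTranspose_smul, hP.eq, mul_add, add_mul,
    mul_one, one_mul, Matrix.smul_mul, Matrix.mul_smul, hPP, smul_smul]
  rw [add_assoc, ← add_smul, ← add_smul, mul_comm (star z), ← add_assoc, hz, zero_smul, add_zero]

/-- The identity plus `z` times the projection onto the line spanned by `eᵢ + eⱼ`, in coordinates:
`z = -2` gives minus the swap of `i` and `j`, and `z = I - 1` a square root of that swap. -/
theorem exists_unitary_mulVec_pair {n : Type*} [Fintype n] [DecidableEq n] {i j : n}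
    (hij : i ≠ j) {z : ℂ} (hz : z + star z + z * star z = 0) :
    ∃ U ∈ Matrix.unitaryGroup n ℂ, ∀ ψ : n → ℂ,
      (U *ᵥ ψ) i = ψ i + z / 2 * (ψ i + ψ j) ∧ (U *ᵥ ψ) j = ψ j + z / 2 * (ψ i + ψ j) := by
  set u : n → ℂ := Pi.single i 1 + Pi.single j 1 with hu
  have hstar : star u = u := by
    ext k; by_cases h1 : k = i <;> by_cases h2 : k = j <;> simp [hu, Pi.single_apply, h1, h2]
  have huψ : ∀ ψ : n → ℂ, u ⬝ᵥ ψ = ψ i + ψ j := fun ψ => by simp [hu, add_dotProduct]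
  have hui : u i = 1 := by simp [hu, hij]
  have huj : u j = 1 := by simp [hu, hij.symm]
  refine ⟨1 + z • ((2⁻¹ : ℂ) • vecMulVec u u), one_add_smul_mem_unitaryGroup ?_ ?_ hz, fun ψ => ?_⟩
  · rw [IsHermitian, conjTranspose_smul, conjTranspose_vecMulVec, hstar]; simp
  · rw [Matrix.smul_mul, Matrix.mul_smul, vecMulVec_mul_vecMulVec, huψ, hui, huj]
    ext a b
    simp [vecMulVec_apply]
    ring
  · simp only [add_mulVec, one_mulVec, smul_mulVec, vecMulVec_mulVec, huψ]
    simp [hui, huj]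
    ring

theorem exists_unitary_mulVec_phase {n : Type*} [Fintype n] [DecidableEq n] {i j : n}
    (hij : i ≠ j) {z : ℂ} (hz : z + star z + z * star z = 0) :
    ∃ U ∈ Matrix.unitaryGroup n ℂ, ∀ ψ : n → ℂ,
      (U *ᵥ ψ) i = ψ i ∧ (U *ᵥ ψ) j = (1 + z) * ψ j := by
  refine ⟨1 + z • Matrix.single j j 1, one_add_smul_mem_unitaryGroup ?_ ?_ hz, fun ψ => ?_⟩
  · simp [IsHermitian]
  · simp
  · simp [add_mulVec, single_mulVec, hij, add_mul]

section SphereMoments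

variable {n : Type*} [Fintype n] {μ : Measure (n → ℂ)}

theorem integrable_of_continuous_of_sphere [IsFiniteMeasure μ]
    (hsphere : ∀ᵐ ψ ∂μ, ∑ i, Complex.normSq (ψ i) = 1) {f : (n → ℂ) → ℝ} (hf : Continuous f) :
    Integrable f μ := by
  obtain ⟨C, hC⟩ := (isCompact_closedBall (0 : n → ℂ) 1).exists_bound_of_continuousOn
    hf.continuousOn
  refine Integrable.of_bound hf.measurable.aestronglyMeasurable C ?_
  filter_upwards [hsphere] with ψ hψ
  refine hC ψ ?_
  rw [mem_closedBall_zero_iff, pi_norm_le_iff_of_nonneg zero_le_one]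
  intro i
  have : Complex.normSq (ψ i) ≤ 1 := hψ ▸ Finset.single_le_sum
    (f := fun i => Complex.normSq (ψ i)) (fun k _ => Complex.normSq_nonneg _) (Finset.mem_univ i)
  rw [Complex.normSq_eq_norm_sq] at this
  exact (sq_le_one_iff₀ (norm_nonneg _)).1 this

variable [DecidableEq n]

theorem integral_comp_unitary_mulVec {E : Type*} [NormedAddCommGroup E] [NormedSpace ℝ E]
    [SecondCountableTopology E]
    (hinv : ∀ U ∈ Matrix.unitaryGroup n ℂ, Measure.map (fun ψ => U *ᵥ ψ) μ = μ)
    {U : Matrix n n ℂ} (hU : U ∈ Matrix.unitaryGroup n ℂ) {f : (n → ℂ) → E} (hf : Continuous f) :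
    ∫ ψ, f (U *ᵥ ψ) ∂μ = ∫ ψ, f ψ ∂μ := by
  have hc : Continuous fun ψ : n → ℂ => U *ᵥ ψ := by fun_prop
  borelize E
  conv_rhs => rw [← hinv U hU]
  rw [integral_map hc.measurable.aemeasurable hf.measurable.aestronglyMeasurable]

theorem integral_normSq_sq_eq
    (hinv : ∀ U ∈ Matrix.unitaryGroup n ℂ, Measure.map (fun ψ => U *ᵥ ψ) μ = μ) (i j : n) :
    ∫ ψ, Complex.normSq (ψ i) ^ 2 ∂μ = ∫ ψ, Complex.normSq (ψ j) ^ 2 ∂μ := by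
  rcases eq_or_ne i j with rfl | hij
  · rfl
  obtain ⟨U, hU, h⟩ := exists_unitary_mulVec_pair hij (z := -2) (by norm_num)
  rw [← integral_comp_unitary_mulVec hinv hU
    (f := fun ψ => Complex.normSq (ψ i) ^ 2) (by fun_prop)]
  refine integral_congr_ae (.of_forall fun ψ => ?_)
  have : (U *ᵥ ψ) i = - ψ j := by rw [(h ψ).1]; ring
  simp only [this, Complex.normSq_neg]

theorem two_mul_integral_normSq_mul_normSq [IsFiniteMeasure μ]
    (hsphere : ∀ᵐ ψ ∂μ, ∑ i, Complex.normSq (ψ i) = 1)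
    (hinv : ∀ U ∈ Matrix.unitaryGroup n ℂ, Measure.map (fun ψ => U *ᵥ ψ) μ = μ)
    {i j : n} (hij : i ≠ j) :
    2 * ∫ ψ, Complex.normSq (ψ i) * Complex.normSq (ψ j) ∂μ =
      ∫ ψ, Complex.normSq (ψ i) ^ 2 ∂μ := by
  have hI : ∀ {f : (n → ℂ) → ℝ}, Continuous f → Integrable f μ :=
    fun hf => integrable_of_continuous_of_sphere hsphere hf
  have hz : (Complex.I - 1) + star (Complex.I - 1) +
      (Complex.I - 1) * star (Complex.I - 1) = 0 := by
    apply Complex.ext <;> norm_num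
  obtain ⟨V, hV, hVψ⟩ := exists_unitary_mulVec_phase hij hz
  obtain ⟨U, hU, hUψ⟩ := exists_unitary_mulVec_pair hij hz
  -- real and imaginary parts of the coherence `ψᵢ ψⱼ*` have the same second moment
  have hcs : ∫ ψ, (ψ i * star (ψ j)).re ^ 2 ∂μ = ∫ ψ, (ψ i * star (ψ j)).im ^ 2 ∂μ := by
    rw [← integral_comp_unitary_mulVec hinv hV
      (f := fun ψ => (ψ i * star (ψ j)).re ^ 2) (by fun_prop)]
    refine integral_congr_ae (.of_forall fun ψ => ?_)
    simp [(hVψ ψ).1, (hVψ ψ).2]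
    ring
  have hsum : ∫ ψ, Complex.normSq (ψ i) * Complex.normSq (ψ j) ∂μ =
      ∫ ψ, (ψ i * star (ψ j)).re ^ 2 ∂μ + ∫ ψ, (ψ i * star (ψ j)).im ^ 2 ∂μ := by
    rw [← integral_add (hI (by fun_prop)) (hI (by fun_prop))]
    refine integral_congr_ae (.of_forall fun ψ => ?_)
    simp [Complex.normSq_apply]
    ring
  have hrot : ∫ ψ, Complex.normSq (ψ i) * Complex.normSq (ψ j) ∂μ =
      4⁻¹ * ∫ ψ, Complex.normSq (ψ i) ^ 2 ∂μ + 4⁻¹ * ∫ ψ, Complex.normSq (ψ j) ^ 2 ∂μ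
        + 2⁻¹ * ∫ ψ, Complex.normSq (ψ i) * Complex.normSq (ψ j) ∂μ
        - ∫ ψ, (ψ i * star (ψ j)).im ^ 2 ∂μ := by
    conv_lhs => rw [← integral_comp_unitary_mulVec hinv hU
      (f := fun ψ => Complex.normSq (ψ i) * Complex.normSq (ψ j)) (by fun_prop)]
    simp only [← integral_const_mul]
    rw [← integral_add (hI (by fun_prop)) (hI (by fun_prop)),
      ← integral_add (hI (by fun_prop)) (hI (by fun_prop)),
      ← integral_sub (hI (by fun_prop)) (hI (by fun_prop))]
    refine integral_congr_ae (.of_forall fun ψ => ?_)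
    simp [(hUψ ψ).1, (hUψ ψ).2, Complex.normSq_apply]
    ring
  have := integral_normSq_sq_eq hinv i j
  linarith

/-- Second moments of the squared coordinate moduli of a uniform point of the complex sphere. -/
theorem integral_normSq_mul_normSq [IsProbabilityMeasure μ]
    (hsphere : ∀ᵐ ψ ∂μ, ∑ i, Complex.normSq (ψ i) = 1)
    (hinv : ∀ U ∈ Matrix.unitaryGroup n ℂ, Measure.map (fun ψ => U *ᵥ ψ) μ = μ) (i j : n) :
    ∫ ψ, Complex.normSq (ψ i) * Complex.normSq (ψ j) ∂μ =
      (1 + if i = j then 1 else 0) / (Fintype.card n * (Fintype.card n + 1)) := by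
  have hI : ∀ {f : (n → ℂ) → ℝ}, Continuous f → Integrable f μ :=
    fun hf => integrable_of_continuous_of_sphere hsphere hf
  set a := ∫ ψ, Complex.normSq (ψ i) ^ 2 ∂μ
  have hval : ∀ k l : n, ∫ ψ, Complex.normSq (ψ k) * Complex.normSq (ψ l) ∂μ =
      a / 2 * (1 + if k = l then 1 else 0) := by
    intro k l
    have hk : ∫ ψ, Complex.normSq (ψ k) ^ 2 ∂μ = a := integral_normSq_sq_eq hinv k i
    split_ifs with h
    · subst h
      simp only [← sq, hk]
      ring
    · linarith [two_mul_integral_normSq_mul_normSq hsphere hinv h]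
  have hone : ∑ k : n, ∑ l : n, a / 2 * (1 + if k = l then (1 : ℝ) else 0) = 1 := by
    simp only [← hval]
    calc _ = ∫ ψ, ∑ k : n, ∑ l : n, Complex.normSq (ψ k) * Complex.normSq (ψ l) ∂μ := by
          rw [integral_finsetSum _ fun k _ => hI (by fun_prop)]
          exact Finset.sum_congr rfl fun k _ =>
            (integral_finsetSum _ fun l _ => hI (by fun_prop)).symm
      _ = ∫ _, (1 : ℝ) ∂μ := by
          refine integral_congr_ae ?_
          filter_upwards [hsphere] with ψ hψ
          rw [← Finset.sum_mul_sum, hψ, one_mul]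
      _ = 1 := by simp
  have hcard : a / 2 * ((Fintype.card n : ℝ) * (Fintype.card n + 1)) = 1 := by
    refine Eq.trans ?_ hone
    simp [← Finset.mul_sum, Finset.sum_add_distrib]
    ring_nf
  rw [hval, eq_inv_of_mul_eq_one_left hcard, mul_comm, ← div_eq_mul_inv]

end SphereMoments

/-- let `B` be a `d×d` Hermitian matrix with `Tr B = 0` and `Tr B² = 1`,
and let `μ` be the normalized rotation-invariant (i.e., unitarily invariant)
probability measure on the unit sphere `{ψ ∈ ℂ^d : ‖ψ‖ = 1}`.  Then
`∫ ⟨ψ, Bψ⟩² dμ(ψ) = 1/(d(d+1))`. -/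
theorem haar_average_quadratic_form (d : ℕ) (hd : 1 ≤ d)
    (B : Matrix (Fin d) (Fin d) ℂ) (hB : B.IsHermitian)
    (htr : B.trace = 0) (htr2 : (B * B).trace = 1)
    (μ : Measure (Fin d → ℂ)) [IsProbabilityMeasure μ]
    (hsphere : ∀ᵐ ψ ∂μ, (∑ i, Complex.normSq (ψ i)) = 1)
    (hinv : ∀ U ∈ Matrix.unitaryGroup (Fin d) ℂ,
      Measure.map (fun ψ => U.mulVec ψ) μ = μ) :
    ∫ ψ, (∑ i, (starRingEnd ℂ) (ψ i) * B.mulVec ψ i) ^ 2 ∂μ =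
      1 / ((d : ℂ) * ((d : ℂ) + 1)) := by
  have hI : ∀ {f : (Fin d → ℂ) → ℝ}, Continuous f → Integrable f μ :=
    fun hf => integrable_of_continuous_of_sphere hsphere hf
  set U : Matrix (Fin d) (Fin d) ℂ := hB.eigenvectorUnitary.1
  have hU : U ∈ Matrix.unitaryGroup (Fin d) ℂ := hB.eigenvectorUnitary.2
  set D : Matrix (Fin d) (Fin d) ℂ := diagonal fun i => (hB.eigenvalues i : ℂ) with hD
  have hUU : Uᴴ * U = 1 := Matrix.mem_unitaryGroup_iff'.1 hU
  have hspec : B = U * D * Uᴴ := by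
    conv_lhs => rw [hB.spectral_theorem]
    rfl
  have hsum : ∑ i, hB.eigenvalues i = 0 := by
    have h : ∑ i, (hB.eigenvalues i : ℂ) = 0 := hB.trace_eq_sum_eigenvalues.symm.trans htr
    exact_mod_cast h
  have hsum_sq : ∑ i, hB.eigenvalues i * hB.eigenvalues i = 1 := by
    have h : B * B = U * (D * D * Uᴴ) := by
      calc B * B = U * D * (Uᴴ * U) * D * Uᴴ := by rw [hspec]; simp only [Matrix.mul_assoc]
        _ = _ := by rw [hUU, Matrix.mul_one]; simp only [Matrix.mul_assoc]
    rw [h, trace_mul_comm, Matrix.mul_assoc, hUU, Matrix.mul_one, hD, diagonal_mul_diagonal,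
      trace_diagonal] at htr2
    exact_mod_cast htr2
  have hdiag : ∀ ψ : Fin d → ℂ, ∑ i, (starRingEnd ℂ) ((U *ᵥ ψ) i) * (B *ᵥ (U *ᵥ ψ)) i =
      ((∑ i, hB.eigenvalues i * Complex.normSq (ψ i) : ℝ) : ℂ) := by
    intro ψ
    have hBU : B * U = U * D := by rw [hspec, Matrix.mul_assoc, hUU, Matrix.mul_one]
    calc _ = star (U *ᵥ ψ) ⬝ᵥ (B *ᵥ (U *ᵥ ψ)) := rfl
      _ = star ψ ⬝ᵥ (D *ᵥ ψ) := by
          rw [star_mulVec, mulVec_mulVec, hBU, dotProduct_mulVec, vecMul_vecMul,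
            ← Matrix.mul_assoc, hUU, Matrix.one_mul, ← dotProduct_mulVec]
      _ = _ := by
          push_cast
          refine Finset.sum_congr rfl fun i _ => ?_
          rw [hD, mulVec_diagonal, Complex.normSq_eq_conj_mul_self]
          simp only [Pi.star_apply, RCLike.star_def]
          ring
  rw [← integral_comp_unitary_mulVec hinv hU
    (f := fun ψ => (∑ i, (starRingEnd ℂ) (ψ i) * B.mulVec ψ i) ^ 2) (by fun_prop)]
  simp only [hdiag, ← Complex.ofReal_pow]
  rw [integral_complex_ofReal]
  have hexp : ∫ ψ : Fin d → ℂ, (∑ i, hB.eigenvalues i * Complex.normSq (ψ i)) ^ 2 ∂μ =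
      ∑ i, ∑ j, hB.eigenvalues i * hB.eigenvalues j *
        ∫ ψ, Complex.normSq (ψ i) * Complex.normSq (ψ j) ∂μ := by
    simp only [sq, Finset.sum_mul_sum]
    rw [integral_finsetSum _ fun i _ => hI (by fun_prop)]
    refine Finset.sum_congr rfl fun i _ => ?_
    rw [integral_finsetSum _ fun j _ => hI (by fun_prop)]
    refine Finset.sum_congr rfl fun j _ => ?_
    simp only [← integral_const_mul, mul_mul_mul_comm]
  have hreal : ∫ ψ : Fin d → ℂ, (∑ i, hB.eigenvalues i * Complex.normSq (ψ i)) ^ 2 ∂μ =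
      1 / ((d : ℝ) * (d + 1)) := by
    simp only [hexp, integral_normSq_mul_normSq hsphere hinv, Fintype.card_fin,
      ← mul_div_assoc, ← Finset.sum_div, mul_add, mul_one, Finset.sum_add_distrib,
      ← Finset.sum_mul_sum, hsum, mul_ite, mul_zero, Finset.sum_ite_eq, Finset.mem_univ,
      if_true, hsum_sq, zero_add]
  rw [hreal]
  push_cast
  rfl
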